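/- There is no mapping F ∈ C^{1,+}(B_{ℓ∞}; c₀) such that F(e_n) = e_n for every n ∈ ℕ. (More generally, there is no F ∈ C^{1,+}(B_{ℓ∞}; c₀) with inf_{n∈ℕ} ‖F(e_n) − F(0)‖ > 0.) This generalizes Phillips' theorem that c₀ is not complemented in ℓ∞. -/

import Mathlib

open Metric

/-- `c₀` viewed inside `ℓ∞ = ℓ∞(ℕ)`: the bounded sequences tending to `0`. -/
def MemCZero (y : lp (fun _ : ℕ => ℝ) ⊤) : Prop :=
  Filter.Tendsto (fun n : ℕ => y n) Filter.atTop (nhds 0)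

/-- The vector obtained from `b` by adding `1 / K` on each of the sets `A 1, …, A k`. -/
noncomputable def staircase {ι : Type*} [DecidableEq ι] (A : ℕ → Finset ι) (K : ℕ) (b : ι → ℝ)
    (k : ℕ) (i : ι) : ℝ :=
  b i + ∑ j ∈ Finset.range k, if i ∈ A (j + 1) then (1 / K : ℝ) else 0

section Staircase

variable {ι : Type*} [DecidableEq ι] {A : ℕ → Finset ι} {K : ℕ} {b : ι → ℝ}

lemma staircase_zero : staircase A K b 0 = b := by
  funext i
  simp [staircase]

lemma staircase_succ (k : ℕ) (i : ι) :
    staircase A K b (k + 1) i =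
      staircase A K b k i + if i ∈ A (k + 1) then (1 / K : ℝ) else 0 := by
  simp only [staircase, Finset.sum_range_succ]
  ring

lemma staircase_of_mem (hA : Antitone A) (hb : ∀ i ∈ A 0, b i = 0) {k : ℕ} {i : ι}
    (hi : i ∈ A k) : staircase A K b k i = k / K := by
  rw [staircase, hb i (hA (Nat.zero_le k) hi), Finset.sum_congr rfl
    (fun j hj => if_pos (hA (Nat.succ_le_of_lt (Finset.mem_range.1 hj)) hi))]
  simp [div_eq_mul_inv]

lemma staircase_mem_Icc (hA : Antitone A) (hb : ∀ i ∈ A 0, b i = 0)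
    (hb01 : ∀ i, b i ∈ Set.Icc (0 : ℝ) 1) {k : ℕ} (hk : k ≤ K) (i : ι) :
    staircase A K b k i ∈ Set.Icc (0 : ℝ) 1 := by
  have h0 : (0 : ℝ) ≤ 1 / K := by positivity
  by_cases hi : i ∈ A 0
  · rw [staircase, hb i hi, zero_add]
    refine ⟨Finset.sum_nonneg fun j _ => by split_ifs <;> simp, ?_⟩
    calc _ ≤ ∑ j ∈ Finset.range k, (1 / K : ℝ) :=
          Finset.sum_le_sum fun j _ => by split_ifs <;> simp
      _ = k / K := by simp [div_eq_mul_inv]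
      _ ≤ 1 := div_le_one_of_le₀ (by exact_mod_cast hk) (by positivity)
  · rw [staircase, Finset.sum_eq_zero, add_zero]
    · exact hb01 i
    · exact fun j _ => if_neg fun h => hi (hA (Nat.zero_le _) h)

variable [Fintype ι]

/-- By symmetry, the total derivative of `g` in the directions of a small subset of a level set,
averaged over all permutations of the coordinates, is small. -/
lemma abs_sum_perm_le {D : (ι → ℝ) → ι → ℝ} {x : ι → ℝ} {C : ℝ} {s : ℕ} (hs : 0 < s)
    (hD : ∀ π : Equiv.Perm ι, ∑ i, |D (x ∘ π) i| ≤ C) {S T : Finset ι} (hTS : T ⊆ S)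
    (hcard : s * T.card ≤ S.card) (hx : ∀ i ∈ S, ∀ j ∈ S, x i = x j) :
    |∑ π : Equiv.Perm ι, ∑ l ∈ T, D (x ∘ π) (π⁻¹ l)| ≤
      Fintype.card (Equiv.Perm ι) * (C / s) := by
  set d : ι → ℝ := fun l => ∑ π : Equiv.Perm ι, D (x ∘ π) (π⁻¹ l) with hd
  have hconst : ∀ i ∈ S, ∀ j ∈ S, d i = d j := by
    intro i hi j hj
    have hxs : x ∘ Equiv.swap i j = x := by
      funext l
      simp only [Function.comp_apply, Equiv.swap_apply_def]
      split_ifs with h1 h2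
      · rw [h1, hx i hi j hj]
      · rw [h2, hx i hi j hj]
      · rfl
    rw [hd]
    refine Fintype.sum_equiv (Equiv.mulLeft (Equiv.swap i j)) _ _ fun π => ?_
    have h1 : x ∘ ⇑(Equiv.swap i j * π) = x ∘ π := by
      rw [Equiv.Perm.coe_mul, ← Function.comp_assoc, hxs]
    simp only [Equiv.coe_mulLeft, h1, mul_inv_rev, Equiv.swap_inv, Equiv.Perm.mul_apply,
      Equiv.swap_apply_right]
  have hsum : ∑ l ∈ S, |d l| ≤ Fintype.card (Equiv.Perm ι) * C := by
    calc ∑ l ∈ S, |d l| ≤ ∑ l, |d l| :=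
          Finset.sum_le_sum_of_subset_of_nonneg (Finset.subset_univ _) fun _ _ _ => abs_nonneg _
      _ ≤ ∑ l, ∑ π : Equiv.Perm ι, |D (x ∘ π) (π⁻¹ l)| :=
          Finset.sum_le_sum fun l _ => Finset.abs_sum_le_sum_abs _ _
      _ = ∑ π : Equiv.Perm ι, ∑ l, |D (x ∘ π) (π⁻¹ l)| := Finset.sum_comm
      _ ≤ ∑ π : Equiv.Perm ι, C := Finset.sum_le_sum fun π _ => by
          rw [Equiv.sum_comp (π⁻¹) fun l => |D (x ∘ π) l|]
          exact hD π
      _ = _ := by simp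
  rw [Finset.sum_comm]
  change |∑ l ∈ T, d l| ≤ _
  have hs' : (0 : ℝ) < s := by exact_mod_cast hs
  rw [← mul_div_assoc, le_div_iff₀ hs']
  refine le_trans ?_ hsum
  rcases S.eq_empty_or_nonempty with rfl | ⟨i, hi⟩
  · simp [Finset.subset_empty.1 hTS]
  · rw [Finset.sum_congr rfl fun l hl => hconst l (hTS hl) i hi,
      Finset.sum_congr rfl fun l hl => congrArg abs (hconst l hl i hi)]
    simp only [Finset.sum_const, nsmul_eq_mul, abs_mul, Nat.abs_cast]
    have : (s * T.card : ℝ) ≤ S.card := by exact_mod_cast hcard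
    nlinarith [abs_nonneg (d i)]

/-- Climbing along a staircase with rapidly decreasing steps changes the average of `g` over all
permutations of the coordinates only slightly. -/
lemma abs_sum_perm_staircase_sub_le {g : (ι → ℝ) → ℝ} {D : (ι → ℝ) → ι → ℝ} {s : ℕ} {C η : ℝ}
    (hK : 0 < K) (hs : 0 < s)
    (hD : ∀ a : ι → ℝ, (∀ i, a i ∈ Set.Icc (0 : ℝ) 1) → ∑ i, |D a i| ≤ C)
    (hg : ∀ a c : ι → ℝ, (∀ i, a i ∈ Set.Icc (0 : ℝ) 1) → (∀ i, c i ∈ Set.Icc (0 : ℝ) 1) →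
      (∀ i, |c i - a i| ≤ 1 / K) → |g c - g a - ∑ i, (c i - a i) * D a i| ≤ η / K)
    (hA : Antitone A) (hcard : ∀ k < K, s * (A (k + 1)).card ≤ (A k).card)
    (hb01 : ∀ i, b i ∈ Set.Icc (0 : ℝ) 1) (hb : ∀ i ∈ A 0, b i = 0) :
    |∑ π : Equiv.Perm ι, (g (staircase A K b K ∘ π) - g (b ∘ π))| ≤
      Fintype.card (Equiv.Perm ι) * (C / s + η) := by
  have hK' : (0 : ℝ) < K := by exact_mod_cast hK
  set P : ℝ := ((Fintype.card (Equiv.Perm ι) : ℕ) : ℝ)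
  have step : ∀ k < K, |∑ π : Equiv.Perm ι,
      (g (staircase A K b (k + 1) ∘ π) - g (staircase A K b k ∘ π))| ≤
        P * (C / s + η) / K := by
    intro k hk
    set x := staircase A K b k with hx
    have hmem := fun i => staircase_mem_Icc (K := K) hA hb hb01 hk.le i
    have hmem' := fun i => staircase_mem_Icc (K := K) hA hb hb01 (Nat.succ_le_of_lt hk) i
    have hsub : ∀ i, staircase A K b (k + 1) i - x i = if i ∈ A (k + 1) then (1 / K : ℝ) else 0 :=
      fun i => by rw [staircase_succ]; ring
    have hπ : ∀ π : Equiv.Perm ι, |g (staircase A K b (k + 1) ∘ π) - g (x ∘ π) -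
        1 / K * ∑ l ∈ A (k + 1), D (x ∘ π) (π⁻¹ l)| ≤ η / K := by
      intro π
      have h := hg (x ∘ π) (staircase A K b (k + 1) ∘ π) (fun i => hmem (π i))
        (fun i => hmem' (π i)) (fun i => by
          simp only [Function.comp_apply, hsub]
          split_ifs <;> simp)
      have e : ∑ i, ((staircase A K b (k + 1) ∘ π) i - (x ∘ π) i) * D (x ∘ π) i =
          1 / K * ∑ l ∈ A (k + 1), D (x ∘ π) (π⁻¹ l) := by
        simp only [Function.comp_apply, hsub]
        rw [← Equiv.sum_comp (π⁻¹)]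
        simp [Finset.mul_sum, Finset.sum_ite_mem]
      rwa [e] at h
    have h1 := abs_sum_perm_le (D := D) (x := x) hs
      (fun π => hD (x ∘ π) fun i => hmem (π i)) (hA (Nat.le_succ k)) (hcard k hk)
      (fun i hi j hj => by rw [hx, staircase_of_mem hA hb hi, staircase_of_mem hA hb hj])
    have h2 : |∑ π : Equiv.Perm ι, (g (staircase A K b (k + 1) ∘ π) - g (x ∘ π) -
        1 / K * ∑ l ∈ A (k + 1), D (x ∘ π) (π⁻¹ l))| ≤ P * (η / K) := by
      refine (Finset.abs_sum_le_sum_abs _ _).trans ((Finset.sum_le_sum fun π _ => hπ π).trans ?_)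
      simp [P]
    rw [Finset.sum_sub_distrib, ← Finset.mul_sum] at h2
    have h3 : |1 / (K : ℝ) * ∑ π : Equiv.Perm ι, ∑ l ∈ A (k + 1), D (x ∘ π) (π⁻¹ l)| ≤
        1 / K * (P * (C / s)) := by
      rw [abs_mul, abs_of_pos (by positivity : (0 : ℝ) < 1 / K)]
      gcongr
    have e : P * (C / s + η) / K = P * (η / K) + 1 / K * (P * (C / s)) := by ring
    rw [e]
    rw [abs_le] at h2 h3 ⊢
    constructor <;> linarith [h2.1, h2.2, h3.1, h3.2]
  have tele : ∀ k ≤ K, |∑ π : Equiv.Perm ι, (g (staircase A K b k ∘ π) - g (b ∘ π))| ≤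
      k * (P * (C / s + η) / K) := by
    intro k
    induction k with
    | zero => simp [staircase_zero]
    | succ k ih =>
      intro hk
      have h1 := ih (by omega)
      have h2 := step k (by omega)
      have e : ∑ π : Equiv.Perm ι, (g (staircase A K b (k + 1) ∘ π) - g (b ∘ π)) =
          ∑ π : Equiv.Perm ι, (g (staircase A K b (k + 1) ∘ π) - g (staircase A K b k ∘ π)) +
          ∑ π : Equiv.Perm ι, (g (staircase A K b k ∘ π) - g (b ∘ π)) := by
        rw [← Finset.sum_add_distrib]
        exact Finset.sum_congr rfl fun _ _ => by ring
      rw [e]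
      push_cast
      linarith [abs_add_le (∑ π : Equiv.Perm ι, (g (staircase A K b (k + 1) ∘ π) -
        g (staircase A K b k ∘ π))) (∑ π : Equiv.Perm ι, (g (staircase A K b k ∘ π) - g (b ∘ π)))]
  have := tele K le_rfl
  rwa [mul_div_cancel₀ _ hK'.ne'] at this

end Staircase

/-- A function on a cube of dimension `s ^ K` with uniformly continuous derivative cannot drop
substantially along each of the edges at the origin. -/
lemma exists_sub_le_single {K s : ℕ} {g : (Fin (s ^ K) → ℝ) → ℝ}
    {D : (Fin (s ^ K) → ℝ) → Fin (s ^ K) → ℝ} {C η : ℝ} (hK : 0 < K) (hs : 0 < s)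
    (hD : ∀ a : Fin (s ^ K) → ℝ, (∀ i, a i ∈ Set.Icc (0 : ℝ) 1) → ∑ i, |D a i| ≤ C)
    (hg : ∀ a c : Fin (s ^ K) → ℝ, (∀ i, a i ∈ Set.Icc (0 : ℝ) 1) →
      (∀ i, c i ∈ Set.Icc (0 : ℝ) 1) →
      (∀ i, |c i - a i| ≤ 1 / K) → |g c - g a - ∑ i, (c i - a i) * D a i| ≤ η / K) :
    ∃ i, g 0 - 2 * (C / s + η) ≤ g (Pi.single i 1) := by
  have hpos : 0 < s ^ K := pow_pos hs K
  have hK' : (0 : ℝ) < K := by exact_mod_cast hK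
  let z : Fin (s ^ K) := ⟨0, hpos⟩
  let A : ℕ → Finset (Fin (s ^ K)) := fun k => Finset.univ.filter fun i => i.1 < s ^ (K - k)
  have hA : Antitone A := fun k l hkl i hi => by
    simp only [A, Finset.mem_filter, Finset.mem_univ, true_and] at hi ⊢
    exact hi.trans_le (Nat.pow_le_pow_right hs (by omega))
  have hAcard : ∀ k, (A k).card = s ^ (K - k) := fun k => by
    have h : s ^ (K - k) ≤ s ^ K := Nat.pow_le_pow_right hs (by omega)
    simp only [A]
    rw [Fin.card_filter_val_lt]
    exact min_eq_right h
  have hz : ∀ k, z ∈ A k := fun k => by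
    simp only [A, Finset.mem_filter, Finset.mem_univ, true_and, z]
    exact pow_pos hs _
  have hcard : ∀ k < K, s * (A (k + 1)).card ≤ (A k).card := fun k hk => by
    rw [hAcard, hAcard, ← pow_succ', show K - (k + 1) + 1 = K - k by omega]
  have h1 := abs_sum_perm_staircase_sub_le (b := 0) hK hs hD hg hA hcard (by simp) (by simp)
  have h2 := abs_sum_perm_staircase_sub_le (A := fun k => (A k).erase z) (b := Pi.single z 1)
    hK hs hD hg (fun k l hkl => Finset.erase_subset_erase z (hA hkl))
    (fun k hk => by
      rw [Finset.card_erase_of_mem (hz _), Finset.card_erase_of_mem (hz _), Nat.mul_sub, mul_one]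
      have := hcard k hk
      omega)
    (fun i => by
      by_cases h : i = z
      · simp [h]
      · simp [Pi.single_eq_of_ne h])
    (fun i hi => Pi.single_eq_of_ne (Finset.ne_of_mem_erase hi) _)
  have e : staircase (fun k => (A k).erase z) K (Pi.single z 1) K = staircase A K 0 K := by
    funext i
    by_cases h : i = z
    · subst h
      rw [staircase_of_mem hA (by simp) (hz K), div_self hK'.ne']
      simp [staircase]
    · simp [staircase, h]
  rw [e] at h2
  by_contra! hcon
  set P : ℝ := ((Fintype.card (Equiv.Perm (Fin (s ^ K))) : ℕ) : ℝ) with hP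
  have hPpos : 0 < P := by rw [hP]; exact_mod_cast Fintype.card_pos
  have h3 : ∑ π : Equiv.Perm (Fin (s ^ K)), (g (Pi.single z 1 ∘ π) - g ((0 : Fin (s ^ K) → ℝ) ∘ π)) <
      ∑ π : Equiv.Perm (Fin (s ^ K)), (-(2 * (C / s + η))) := by
    refine Finset.sum_lt_sum_of_nonempty Finset.univ_nonempty fun π _ => ?_
    have e1 : (Pi.single z 1 : Fin (s ^ K) → ℝ) ∘ π = Pi.single (π⁻¹ z) 1 := by
      funext i
      simp only [Function.comp_apply, Pi.single_apply, Equiv.Perm.eq_inv_iff_eq]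
    have e2 : (0 : Fin (s ^ K) → ℝ) ∘ π = 0 := rfl
    rw [e1, e2]
    linarith [hcon (π⁻¹ z)]
  simp only [Finset.sum_const, Finset.card_univ, nsmul_eq_mul, Finset.sum_sub_distrib] at h1 h2 h3
  rw [abs_le] at h1 h2
  linarith [h1.1, h1.2, h2.1, h2.2]

/-- A uniformly continuous map on the unit ball is bounded. -/
lemma exists_norm_le_of_uniformContinuousOn_ball {E G : Type*} [NormedAddCommGroup E]
    [NormedSpace ℝ E] [NormedAddCommGroup G] {F : E → G}
    (h : UniformContinuousOn F (ball 0 1)) :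
    ∃ C, 0 ≤ C ∧ ∀ x ∈ ball (0 : E) 1, ‖F x‖ ≤ C := by
  obtain ⟨d, hd, hF⟩ := Metric.uniformContinuousOn_iff.1 h 1 one_pos
  obtain ⟨n, hn⟩ := exists_nat_one_div_lt hd
  have hn' : (0 : ℝ) < n + 1 := by positivity
  refine ⟨‖F 0‖ + (n + 1), by positivity, fun x hx => ?_⟩
  have hmem : ∀ k : ℕ, k ≤ n + 1 → ((k : ℝ) / (n + 1)) • x ∈ ball (0 : E) 1 := fun k hk => by
    rw [mem_ball_zero_iff] at hx ⊢
    rw [norm_smul, Real.norm_of_nonneg (by positivity)]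
    have : (k : ℝ) / (n + 1) ≤ 1 := div_le_one_of_le₀ (by exact_mod_cast hk) hn'.le
    nlinarith [norm_nonneg x]
  have hk : ∀ k : ℕ, k ≤ n + 1 → ‖F (((k : ℝ) / (n + 1)) • x)‖ ≤ ‖F 0‖ + k := by
    intro k
    induction k with
    | zero => simp
    | succ k ih =>
      intro hk
      have h1 := hF _ (hmem (k + 1) hk) _ (hmem k (by omega)) (by
        rw [dist_eq_norm, ← sub_smul, norm_smul,
          show (((k + 1 : ℕ) : ℝ) / (n + 1) - k / (n + 1)) = 1 / (n + 1) by push_cast; ring,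
          Real.norm_of_nonneg (by positivity)]
        rw [mem_ball_zero_iff] at hx
        have : (0 : ℝ) < 1 / (n + 1) := by positivity
        nlinarith)
      rw [dist_eq_norm] at h1
      have h2 := ih (by omega)
      have h3 := norm_le_norm_add_norm_sub' (F ((((k + 1 : ℕ) : ℝ) / (n + 1)) • x))
        (F (((k : ℝ) / (n + 1)) • x))
      push_cast at *
      linarith
  have := hk (n + 1) le_rfl
  push_cast at this
  rwa [div_self hn'.ne', one_smul] at this

section NormedSpace

variable {E G : Type*} [NormedAddCommGroup E] [NormedSpace ℝ E] [NormedAddCommGroup G]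
  [NormedSpace ℝ G] {F : E → G} {F' : E → (E →L[ℝ] G)}

/-- Among sufficiently many vectors spanning a copy of `ℓ∞^N`, there is one along which a given
functional of `F` does not drop substantially. -/
lemma exists_sub_le_apply_add {K s : ℕ} {C η : ℝ} (hK : 0 < K) (hs : 0 < s)
    (hF : ∀ x ∈ ball (0 : E) 1, HasFDerivAt F (F' x) x)
    (hC : ∀ x ∈ ball (0 : E) 1, ‖F' x‖ ≤ C)
    (hη : ∀ x ∈ ball (0 : E) 1, ∀ z ∈ ball (0 : E) 1, ‖z - x‖ ≤ 1 / K → ‖F' z - F' x‖ ≤ η)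
    {φ : G →L[ℝ] ℝ} (hφ : ‖φ‖ ≤ 1) {y : E} {u : Fin (s ^ K) → E}
    (hu : ∀ a : Fin (s ^ K) → ℝ, (∀ i, |a i| ≤ 1) → ‖∑ i, a i • u i‖ ≤ 1)
    (hy : ∀ a : Fin (s ^ K) → ℝ, (∀ i, a i ∈ Set.Icc (0 : ℝ) 1) → ‖y + ∑ i, a i • u i‖ < 1) :
    ∃ i, φ (F y) - 2 * (C / s + η) ≤ φ (F (y + u i)) := by
  have hK' : (0 : ℝ) < K := by exact_mod_cast hK
  have hball : ∀ a : Fin (s ^ K) → ℝ, (∀ i, a i ∈ Set.Icc (0 : ℝ) 1) →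
      y + ∑ i, a i • u i ∈ ball (0 : E) 1 := fun a ha => by
    simpa using hy a ha
  have hη0 : 0 ≤ η := (norm_nonneg _).trans
    (hη 0 (by simp) 0 (by simp) (by simp))
  have key := exists_sub_le_single (g := fun a => φ (F (y + ∑ i, a i • u i)))
    (D := fun a i => φ (F' (y + ∑ j, a j • u j) (u i))) (C := C) (η := η) hK hs ?_ ?_
  · obtain ⟨i, hi⟩ := key
    refine ⟨i, ?_⟩
    simpa [Pi.single_apply, ite_smul] using hi
  · intro a ha
    set L := F' (y + ∑ j, a j • u j) with hL
    have hsgn : ∀ t : ℝ, |(SignType.sign t : ℝ)| ≤ 1 := fun t => by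
      rcases lt_trichotomy t 0 with h | h | h <;> simp [h]
    calc ∑ i, |φ (L (u i))|
        = φ (L (∑ i, (SignType.sign (φ (L (u i))) : ℝ) • u i)) := by
          simp only [map_sum, map_smul, smul_eq_mul, sign_mul_self]
      _ ≤ ‖φ (L (∑ i, (SignType.sign (φ (L (u i))) : ℝ) • u i))‖ := le_abs_self _
      _ ≤ ‖φ‖ * ‖L (∑ i, (SignType.sign (φ (L (u i))) : ℝ) • u i)‖ := φ.le_opNorm _
      _ ≤ 1 * (‖L‖ * 1) := by
          gcongr
          refine (L.le_opNorm _).trans ?_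
          gcongr
          exact hu _ fun i => hsgn _
      _ ≤ C := by
          rw [one_mul, mul_one]
          exact hC _ (hball a ha)
  · intro a c ha hc hac
    set x := y + ∑ i, a i • u i with hx
    set z := y + ∑ i, c i • u i with hz
    have hzx : z - x = ∑ i, (c i - a i) • u i := by
      simp [hx, hz, sub_smul, Finset.sum_sub_distrib]
    have hnorm : ‖z - x‖ ≤ 1 / K := by
      have h := hu (fun i => K * (c i - a i)) fun i => by
        rw [abs_mul, Nat.abs_cast]
        calc (K : ℝ) * |c i - a i| ≤ K * (1 / K) := by gcongr; exact hac i
          _ = 1 := mul_one_div_cancel hK'.ne'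
      simp only [mul_smul, ← Finset.smul_sum, ← hzx] at h
      rw [norm_smul, Real.norm_natCast] at h
      rwa [le_div_iff₀' hK']
    have hconv : Convex ℝ (ball (0 : E) 1 ∩ closedBall x (1 / K)) :=
      (convex_ball _ _).inter (convex_closedBall _ _)
    have hmv := hconv.norm_image_sub_le_of_norm_hasFDerivWithin_le'
      (f := fun w => φ (F w)) (f' := fun w => φ.comp (F' w)) (φ := φ.comp (F' x)) (C := η)
      (x := x) (y := z)
      (fun w hw => (φ.hasFDerivAt.comp w (hF w hw.1)).hasFDerivWithinAt)
      (fun w hw => by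
        rw [← ContinuousLinearMap.comp_sub]
        refine (φ.opNorm_comp_le _).trans ?_
        calc ‖φ‖ * ‖F' w - F' x‖ ≤ 1 * η := by
              gcongr
              exact hη x (hball a ha) w hw.1 (by simpa [dist_eq_norm] using hw.2)
          _ = η := one_mul η)
      ⟨hball a ha, by simp⟩ ⟨hball c hc, by simpa [dist_eq_norm] using hnorm⟩
    have e : φ.comp (F' x) (z - x) = ∑ i, (c i - a i) * φ (F' x (u i)) := by
      rw [hzx]
      simp
    rw [e, Real.norm_eq_abs] at hmv
    calc _ ≤ η * ‖z - x‖ := hmv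
      _ ≤ η * (1 / K) := by gcongr
      _ = η / K := by ring

/-- A map continuous on the closed unit ball with bounded derivative inside varies little along
the end of a radius. -/
lemma norm_sub_smul_le {C r : ℝ} (hFc : ContinuousOn F (closedBall 0 1))
    (hF : ∀ x ∈ ball (0 : E) 1, HasFDerivAt F (F' x) x)
    (hC : ∀ x ∈ ball (0 : E) 1, ‖F' x‖ ≤ C) {x : E} (hx : ‖x‖ ≤ 1) (hr0 : 0 ≤ r) (hr : r < 1) :
    ‖F x - F (r • x)‖ ≤ C * (1 - r) := by
  have hC0 : 0 ≤ C := (norm_nonneg _).trans (hC 0 (by simp))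
  have hnorm : ∀ t : ℝ, 0 ≤ t → ‖t • x‖ ≤ t := fun t ht => by
    rw [norm_smul, Real.norm_of_nonneg ht]
    exact mul_le_of_le_one_right ht hx
  have hlim : Filter.Tendsto (fun t : ℝ => ‖F (t • x) - F (r • x)‖)
      (nhdsWithin 1 (Set.Ioo r 1)) (nhds ‖F x - F (r • x)‖) := by
    refine Filter.Tendsto.norm (Filter.Tendsto.sub_const ?_ _)
    have h1 : Filter.Tendsto F (nhdsWithin x (closedBall 0 1)) (nhds (F x)) :=
      hFc x (by simpa using hx)
    refine h1.comp (tendsto_nhdsWithin_iff.2 ⟨?_, ?_⟩)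
    · have : Filter.Tendsto (fun t : ℝ => t • x) (nhds 1) (nhds ((1 : ℝ) • x)) :=
        (continuous_id.smul continuous_const).tendsto 1
      rw [one_smul] at this
      exact this.mono_left nhdsWithin_le_nhds
    · filter_upwards [self_mem_nhdsWithin] with t ht
      rw [mem_closedBall_zero_iff]
      exact (hnorm t (hr0.trans ht.1.le)).trans ht.2.le
  have hne : (nhdsWithin (1 : ℝ) (Set.Ioo r 1)).NeBot := by
    rw [← mem_closure_iff_nhdsWithin_neBot, closure_Ioo hr.ne]
    exact ⟨hr.le, le_rfl⟩
  refine le_of_tendsto hlim ?_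
  filter_upwards [self_mem_nhdsWithin] with t ht
  have h := (convex_ball (0 : E) 1).norm_image_sub_le_of_norm_hasFDerivWithin_le
    (f := F) (f' := F') (C := C) (x := r • x) (y := t • x)
    (fun w hw => (hF w hw).hasFDerivWithinAt) hC
    (mem_ball_zero_iff.2 ((hnorm r hr0).trans_lt hr))
    (mem_ball_zero_iff.2 ((hnorm t (hr0.trans ht.1.le)).trans_lt ht.2))
  refine h.trans ?_
  gcongr
  rw [← sub_smul]
  exact (hnorm _ (sub_nonneg.2 ht.1.le)).trans (by linarith [ht.2])

end NormedSpace

/-- A Rosenthal-type selection principle: if none of the functions `H n` can drop by `ε` along each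
of `N ε` pairwise disjoint sets, then there is an infinite set `M` such that enlarging `{n}` to `M`
does not decrease `H n` by more than `2 * ε`, for all `n ∈ M`. -/
lemma exists_infinite_subset_sub_le {H : ℕ → Set ℕ → ℝ}
    (hH : ∀ ε > 0, ∃ N : ℕ, ∀ (n : ℕ) (B : Set ℕ) (A : Fin N → Set ℕ),
      Pairwise (fun i j => Disjoint (A i) (A j)) → (∀ i, Disjoint B (A i)) →
      ∃ i, H n B - ε ≤ H n (B ∪ A i))
    {S : Set ℕ} (hS : S.Infinite) {ε : ℝ} (hε : 0 < ε) :
    ∃ M ⊆ S, M.Infinite ∧ ∀ n ∈ M, H n {n} - 2 * ε ≤ H n M := by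
  let Inv : Set ℕ × Set ℕ → Prop := fun p => p.2 ⊆ S ∧ p.2.Infinite ∧ Disjoint p.1 p.2 ∧
    ∃ b < ε, ∀ n ∈ p.2, H n {n} - b ≤ H n (p.1 ∪ {n})
  have step : ∀ p : {p // Inv p}, ∃ q : ℕ × {p // Inv p}, q.1 ∈ p.1.2 ∧
      q.2.1.1 = p.1.1 ∪ {q.1} ∧ q.2.1.2 ⊆ p.1.2 ∧ q.1 ∉ q.2.1.2 ∧
      ∀ T ⊆ q.2.1.2, H q.1 q.2.1.1 - ε ≤ H q.1 (q.2.1.1 ∪ T) := by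
    rintro ⟨⟨s, R⟩, hRS, hR, hsR, b, hb, hRb⟩
    obtain ⟨N, hN⟩ := hH ((ε - b) / 2) (by linarith)
    let c : Fin N → ℕ := fun i => hR.natEmbedding R i
    have hc : Function.Injective c := fun i j hij => by
      simpa [c, Subtype.val_inj, Fin.val_inj] using hij
    have hcR : ∀ i, c i ∈ R := fun i => (hR.natEmbedding R i).2
    have hR1 : (R \ Set.range c).Infinite := hR.sdiff (Set.finite_range c)
    obtain ⟨i, hi⟩ : ∃ i, {n ∈ R \ Set.range c |
        H n (s ∪ {n}) - (ε - b) / 2 ≤ H n (s ∪ {n} ∪ {c i})}.Infinite := by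
      by_contra! hcon
      refine hR1 ((Set.finite_iUnion hcon).subset fun n hn => ?_)
      obtain ⟨i, hi⟩ := hN n (s ∪ {n}) (fun i => {c i})
        (fun i j hij => by simpa using fun h => hij (hc h))
        (fun i => by
          rw [Set.disjoint_singleton_right]
          rintro (h | h)
          · exact Set.disjoint_left.1 hsR h (hcR i)
          · exact hn.2 ⟨i, h⟩)
      exact Set.mem_iUnion.2 ⟨i, hn, hi⟩
    set m := c i
    set R1 := {n ∈ R \ Set.range c | H n (s ∪ {n}) - (ε - b) / 2 ≤ H n (s ∪ {n} ∪ {m})}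
    have hmR1 : m ∉ R1 := fun h => h.1.2 ⟨i, rfl⟩
    have hR1R : R1 ⊆ R := fun n hn => hn.1.1
    have hdisj : Disjoint (s ∪ {m}) R1 := by
      rw [Set.disjoint_union_left, Set.disjoint_singleton_left]
      exact ⟨hsR.mono_right hR1R, hmR1⟩
    obtain ⟨N', hN'⟩ := hH ε hε
    let e : ℕ → ℕ := fun k => hi.natEmbedding R1 k
    have he : Function.Injective e := fun k l hkl => by
      simpa [e, Subtype.val_inj] using hkl
    let A : Fin N' → Set ℕ := fun j => e '' {k | k % N' = j}
    have hAR1 : ∀ j, A j ⊆ R1 := by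
      rintro j _ ⟨k, -, rfl⟩
      exact (hi.natEmbedding R1 k).2
    have hA : ∀ j, (A j).Infinite := fun j => by
      refine Set.Infinite.image he.injOn (Set.infinite_of_injective_forall_mem
        (f := fun k : ℕ => j.1 + N' * k) (fun k l hkl => ?_) fun k => ?_)
      · have : 0 < N' := j.pos
        simpa [this.ne'] using hkl
      · simp [Nat.add_mul_mod_self_left, Nat.mod_eq_of_lt j.2]
    have hAA : Pairwise fun i j => Disjoint (A i) (A j) := fun i j hij => by
      refine (Set.disjoint_image_iff he).2 (Set.disjoint_left.2 fun k hk hk' => hij ?_)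
      exact Fin.ext (hk.symm.trans hk')
    obtain ⟨j, hj⟩ : ∃ j, ∀ T ⊆ A j, H m (s ∪ {m}) - ε ≤ H m (s ∪ {m} ∪ T) := by
      by_contra! hcon
      choose T hTA hT using hcon
      obtain ⟨j, hj⟩ := hN' m (s ∪ {m}) T
        (fun i j hij => (hAA hij).mono (hTA i) (hTA j))
        (fun j => hdisj.mono_right ((hTA j).trans (hAR1 j)))
      exact absurd hj (not_le.2 (hT j))
    refine ⟨⟨m, ⟨⟨s ∪ {m}, A j⟩, ((hAR1 j).trans hR1R).trans hRS, hA j,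
      hdisj.mono_right (hAR1 j), b + (ε - b) / 2, by linarith, fun n hn => ?_⟩⟩, hcR i, rfl,
      (hAR1 j).trans hR1R, fun h => hmR1 (hAR1 j h), hj⟩
    have h1 := hRb n (hR1R (hAR1 j hn))
    have h2 := (hAR1 j hn).2
    rw [Set.union_right_comm] at h2
    simp only at h1 ⊢
    linarith
  choose f hf using step
  let p : ℕ → {p // Inv p} := fun k => Nat.rec ⟨⟨∅, S⟩, subset_rfl, hS, Set.empty_disjoint _,
    0, hε, by simp⟩ (fun _ p => (f p).2) k
  let m : ℕ → ℕ := fun k => (f (p k)).1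
  have hanti : Antitone fun k => (p k).1.2 := antitone_nat_of_succ_le fun k => (hf (p k)).2.2.1
  have hmR : ∀ {k l}, k ≤ l → m l ∈ (p k).1.2 := fun {k l} hkl => hanti hkl (hf (p l)).1
  have hlt : ∀ {k l}, k < l → m k ≠ m l := fun {k l} hkl h => by
    have h1 : m l ∈ (p (k + 1)).1.2 := hmR (Nat.succ_le_of_lt hkl)
    rw [← h] at h1
    exact (hf (p k)).2.2.2.1 h1
  have hinj : Function.Injective m := fun k l hkl => by
    rcases lt_trichotomy k l with h | h | h
    · exact absurd hkl (hlt h)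
    · exact h
    · exact absurd hkl.symm (hlt h)
  have hs : ∀ k, (p k).1.1 = m '' Set.Iio k := by
    intro k
    induction k with
    | zero => simp [p]
    | succ k ih =>
      have h1 : (p (k + 1)).1.1 = (p k).1.1 ∪ {m k} := (hf (p k)).2.1
      rw [h1, ih, ← Set.image_singleton, ← Set.image_union]
      congr 1
      ext l
      simp
  refine ⟨Set.range m, ?_, Set.infinite_range_of_injective hinj, ?_⟩
  · rintro _ ⟨k, rfl⟩
    exact hmR (Nat.zero_le k)
  · rintro _ ⟨k, rfl⟩
    obtain ⟨b, hb, hRb⟩ := (p k).2.2.2.2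
    have h1 := hRb (m k) (hmR le_rfl)
    have h2 : H (m k) (p (k + 1)).1.1 - ε ≤
        H (m k) ((p (k + 1)).1.1 ∪ m '' Set.Ici (k + 1)) := by
      refine (hf (p k)).2.2.2.2 _ ?_
      rintro _ ⟨l, hl, rfl⟩
      exact hmR hl
    have h3 : (p (k + 1)).1.1 = (p k).1.1 ∪ {m k} := (hf (p k)).2.1
    have h4 : (p (k + 1)).1.1 ∪ m '' Set.Ici (k + 1) = Set.range m := by
      rw [hs (k + 1), ← Set.image_union, Set.Iio_union_Ici, Set.image_univ]
    rw [h4, h3] at h2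
    linarith

/-- The indicator of a set of natural numbers, as an element of `ℓ∞`. -/
noncomputable def lpIndicator (A : Set ℕ) : lp (fun _ : ℕ => ℝ) ⊤ :=
  ⟨A.indicator 1, memℓp_infty ⟨1, by
    rintro _ ⟨n, rfl⟩
    by_cases h : n ∈ A <;> simp [h]⟩⟩

lemma lpIndicator_apply (A : Set ℕ) (n : ℕ) : lpIndicator A n = A.indicator 1 n := rfl

lemma norm_lpIndicator_le (A : Set ℕ) : ‖lpIndicator A‖ ≤ 1 :=
  lp.norm_le_of_forall_le zero_le_one fun n => by
    rw [lpIndicator_apply]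
    by_cases h : n ∈ A <;> simp [h]

lemma lpIndicator_empty : lpIndicator ∅ = 0 := by
  ext n
  simp [lpIndicator_apply]

lemma lpIndicator_singleton (n : ℕ) : lpIndicator {n} = lp.single ⊤ n 1 := by
  ext k
  rw [lpIndicator_apply, lp.single_apply]
  by_cases h : k = n <;> simp [h]

lemma lpIndicator_union {A B : Set ℕ} (h : Disjoint A B) :
    lpIndicator (A ∪ B) = lpIndicator A + lpIndicator B := by
  ext n
  simp [lpIndicator_apply, Set.indicator_union_of_disjoint h]

/-- A combination of indicators of disjoint sets with coefficients of modulus at most `1` has norm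
at most `1`. -/
lemma norm_lpIndicator_add_sum_le {N : ℕ} {A : Fin N → Set ℕ} {B : Set ℕ}
    (hA : Pairwise fun i j => Disjoint (A i) (A j)) (hB : ∀ i, Disjoint B (A i))
    {a : Fin N → ℝ} (ha : ∀ i, |a i| ≤ 1) :
    ‖lpIndicator B + ∑ i, a i • lpIndicator (A i)‖ ≤ 1 := by
  refine lp.norm_le_of_forall_le zero_le_one fun n => ?_
  have e : (lpIndicator B + ∑ i, a i • lpIndicator (A i) : lp (fun _ : ℕ => ℝ) ⊤) n =
      B.indicator 1 n + ∑ i, a i * (A i).indicator 1 n := by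
    have ev : ∀ v : lp (fun _ : ℕ => ℝ) ⊤, v n = lp.evalCLM ℝ (fun _ : ℕ => ℝ) ⊤ n v :=
      fun v => by simp [lp.evalCLM]
    rw [ev]
    rw [map_add, map_sum]
    simp only [map_smul]
    simp only [← ev, lpIndicator_apply, smul_eq_mul]
  rw [e]
  by_cases hn : ∃ i, n ∈ A i
  · obtain ⟨i, hi⟩ := hn
    rw [Finset.sum_eq_single i, Set.indicator_of_notMem fun h => Set.disjoint_left.1 (hB i) h hi]
    · simpa [hi] using ha i
    · intro j _ hj
      rw [Set.indicator_of_notMem fun h => Set.disjoint_left.1 (hA hj) h hi, mul_zero]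
    · simp
  · rw [Finset.sum_eq_zero fun i _ => by
      rw [Set.indicator_of_notMem fun h => hn ⟨i, h⟩, mul_zero]]
    by_cases h : n ∈ B <;> simp [h]

/-- For maps on `ℓ∞` with uniformly continuous derivative, functionals of norm at most `1` cannot
drop by `ε` along the indicators of too many disjoint sets. -/
lemma exists_sub_le_apply_lpIndicator_union {G : Type*} [NormedAddCommGroup G] [NormedSpace ℝ G]
    {F : lp (fun _ : ℕ => ℝ) ⊤ → G} {F' : lp (fun _ : ℕ => ℝ) ⊤ → (lp (fun _ : ℕ => ℝ) ⊤ →L[ℝ] G)}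
    (hF : ∀ x ∈ ball (0 : lp (fun _ : ℕ => ℝ) ⊤) 1, HasFDerivAt F (F' x) x)
    (hF' : UniformContinuousOn F' (ball 0 1)) {r : ℝ} (hr0 : 0 ≤ r) (hr : r < 1)
    {ε : ℝ} (hε : 0 < ε) :
    ∃ N : ℕ, ∀ φ : G →L[ℝ] ℝ, ‖φ‖ ≤ 1 → ∀ (B : Set ℕ) (A : Fin N → Set ℕ),
      Pairwise (fun i j => Disjoint (A i) (A j)) → (∀ i, Disjoint B (A i)) →
      ∃ i, φ (F (r • lpIndicator B)) - ε ≤ φ (F (r • lpIndicator (B ∪ A i))) := by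
  obtain ⟨C, hC0, hC⟩ := exists_norm_le_of_uniformContinuousOn_ball hF'
  obtain ⟨d, hd, hd'⟩ := Metric.uniformContinuousOn_iff.1 hF' (ε / 4) (by positivity)
  obtain ⟨k, hk⟩ := exists_nat_one_div_lt hd
  obtain ⟨l, hl⟩ := exists_nat_gt (4 * C / ε)
  have hCl : C / ((l + 1 : ℕ) : ℝ) ≤ ε / 4 := by
    rw [div_le_iff₀ (by positivity)]
    rw [div_lt_iff₀ hε] at hl
    push_cast
    nlinarith
  refine ⟨(l + 1) ^ (k + 1), fun φ hφ B A hA hB => ?_⟩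
  have hsum : ∀ (B : Set ℕ) (a : Fin ((l + 1) ^ (k + 1)) → ℝ), (∀ i, Disjoint B (A i)) →
      (∀ i, |a i| ≤ 1) → ‖r • lpIndicator B + ∑ i, a i • r • lpIndicator (A i)‖ ≤ r := by
    intro B a hB ha
    simp only [smul_comm _ r]
    rw [← Finset.smul_sum, ← smul_add, norm_smul, Real.norm_of_nonneg hr0]
    exact mul_le_of_le_one_right hr0 (norm_lpIndicator_add_sum_le hA hB ha)
  obtain ⟨i, hi⟩ := exists_sub_le_apply_add (K := k + 1) (s := l + 1) (C := C) (η := ε / 4)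
    (y := r • lpIndicator B) (u := fun i => r • lpIndicator (A i)) k.succ_pos l.succ_pos hF hC
    (fun x hx z hz hxz => by
      rw [← dist_eq_norm]
      refine (hd' z hz x hx ?_).le
      rw [dist_eq_norm]
      push_cast at hxz
      exact hxz.trans_lt hk) hφ
    (fun a ha => by
      have h := hsum ∅ a (fun i => Set.empty_disjoint _) ha
      rw [lpIndicator_empty, smul_zero, zero_add] at h
      exact h.trans hr.le)
    (fun a ha => (hsum B a hB fun i => abs_le.2 ⟨by linarith [(ha i).1], (ha i).2⟩).trans_lt hr)
  refine ⟨i, ?_⟩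
  rw [lpIndicator_union (hB i), smul_add]
  linarith

/-- The coordinate functionals on `ℓ∞`, with a sign. -/
noncomputable def signedEval (q : ℕ × Bool) : lp (fun _ : ℕ => ℝ) ⊤ →L[ℝ] ℝ :=
  (if q.2 then 1 else -1 : ℝ) • lp.evalCLM ℝ (fun _ : ℕ => ℝ) ⊤ q.1

lemma abs_signedEval_apply (q : ℕ × Bool) (v : lp (fun _ : ℕ => ℝ) ⊤) :
    |signedEval q v| = |v q.1| := by
  rcases q with ⟨p, _ | _⟩ <;> simp [signedEval, lp.evalCLM]

lemma norm_signedEval_le (q : ℕ × Bool) : ‖signedEval q‖ ≤ 1 :=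
  ContinuousLinearMap.opNorm_le_bound _ zero_le_one fun v => by
    rw [Real.norm_eq_abs, abs_signedEval_apply, one_mul]
    exact lp.norm_apply_le_norm ENNReal.top_ne_zero v q.1

lemma exists_lt_signedEval {v : lp (fun _ : ℕ => ℝ) ⊤} {c : ℝ} (hc : 0 ≤ c) (hv : c < ‖v‖) :
    ∃ q, c < signedEval q v := by
  by_contra! h
  refine absurd (lp.norm_le_of_forall_le hc fun n => abs_le.2 ⟨?_, ?_⟩) (not_le.2 hv)
  · have := h (n, false)
    simp [signedEval, lp.evalCLM] at this
    linarith
  · simpa [signedEval, lp.evalCLM] using h (n, true)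

/-- A `C^{1,+}` map from the unit ball of `ℓ∞` to `c₀` cannot keep the images of infinitely many
unit vectors away from the image of `0`. -/
lemma false_of_infinite_le_norm_single_sub
    {F : lp (fun _ : ℕ => ℝ) ⊤ → lp (fun _ : ℕ => ℝ) ⊤}
    {F' : lp (fun _ : ℕ => ℝ) ⊤ → (lp (fun _ : ℕ => ℝ) ⊤ →L[ℝ] lp (fun _ : ℕ => ℝ) ⊤)}
    (hFc : ContinuousOn F (closedBall 0 1))
    (hF0 : ∀ x ∈ closedBall (0 : lp (fun _ : ℕ => ℝ) ⊤) 1, MemCZero (F x))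
    (hF : ∀ x ∈ ball (0 : lp (fun _ : ℕ => ℝ) ⊤) 1, HasFDerivAt F (F' x) x)
    (hF' : UniformContinuousOn F' (ball 0 1)) {S : Set ℕ} (hS : S.Infinite) {δ : ℝ} (hδ : 0 < δ)
    (hSδ : ∀ n ∈ S, δ ≤ ‖F (lp.single ⊤ n 1) - F 0‖) : False := by
  obtain ⟨C, hC0, hC⟩ := exists_norm_le_of_uniformContinuousOn_ball hF'
  obtain ⟨r, hr0, hr, hCr⟩ : ∃ r : ℝ, 0 ≤ r ∧ r < 1 ∧ C * (1 - r) < δ / 2 := by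
    refine ⟨1 - min 1 (δ / (2 * (C + 1))), by simp, ?_, ?_⟩
    · have : 0 < min 1 (δ / (2 * (C + 1))) := by positivity
      linarith
    · rw [sub_sub_cancel]
      calc C * min 1 (δ / (2 * (C + 1))) ≤ C * (δ / (2 * (C + 1))) := by
            gcongr
            exact min_le_right _ _
        _ < δ / 2 := by
            rw [mul_div_assoc', div_lt_div_iff₀ (by positivity) (by positivity)]
            nlinarith
  have hlarge : ∀ n ∈ S, δ / 2 < ‖F (r • lpIndicator {n}) - F 0‖ := fun n hn => by
    rw [lpIndicator_singleton]
    have h1 := norm_sub_smul_le hFc hF hC (x := lp.single ⊤ n (1 : ℝ))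
      (by rw [lp.norm_single (by simp)]; simp) hr0 hr
    have h2 := norm_sub_le_norm_sub_add_norm_sub (F (lp.single ⊤ n 1))
      (F (r • lp.single ⊤ n (1 : ℝ))) (F 0)
    linarith [hSδ n hn]
  have hq : ∀ n, ∃ q, n ∈ S → δ / 2 < signedEval q (F (r • lpIndicator {n}) - F 0) := fun n => by
    by_cases hn : n ∈ S
    · obtain ⟨q, hq⟩ := exists_lt_signedEval (by positivity) (hlarge n hn)
      exact ⟨q, fun _ => hq⟩
    · exact ⟨(0, true), fun h => absurd h hn⟩
  choose q hq using hq
  have hdrop := fun (ε : ℝ) (hε : 0 < ε) =>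
    exists_sub_le_apply_lpIndicator_union hF hF' hr0 hr hε
  obtain ⟨M, hMS, hM, hMH⟩ := exists_infinite_subset_sub_le
    (H := fun n A => signedEval (q n) (F (r • lpIndicator A)))
    (fun ε hε => (hdrop ε hε).imp fun N hN n B A hA hB =>
      hN (signedEval (q n)) (norm_signedEval_le _) B A hA hB)
    hS (ε := δ / 8) (by positivity)
  have hmem : ∀ A, r • lpIndicator A ∈ closedBall (0 : lp (fun _ : ℕ => ℝ) ⊤) 1 := fun A => by
    rw [mem_closedBall_zero_iff, norm_smul, Real.norm_of_nonneg hr0]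
    exact mul_le_one₀ hr.le (norm_nonneg _) (norm_lpIndicator_le A)
  have htend : Filter.Tendsto (fun p : ℕ => F (r • lpIndicator M) p - F 0 p) Filter.atTop
      (nhds 0) := by
    simpa using (hF0 _ (hmem M)).sub (hF0 0 (by simp))
  obtain ⟨P, hP⟩ := Metric.tendsto_atTop.1 htend (δ / 4) (by positivity)
  have hqP : q '' M ⊆ Set.Iio P ×ˢ Set.univ := by
    rintro _ ⟨n, hn, rfl⟩
    refine ⟨?_, Set.mem_univ _⟩
    by_contra! hPn
    have h1 := hP (q n).1 (by simpa using hPn)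
    have h2 := abs_signedEval_apply (q n) (F (r • lpIndicator M) - F 0)
    have h3 := hq n (hMS hn)
    have h4 := hMH n hn
    have h5 := le_abs_self (signedEval (q n) (F (r • lpIndicator M) - F 0))
    rw [h2, lp.coeFn_sub, Pi.sub_apply, map_sub] at h5
    rw [map_sub] at h3
    rw [Real.dist_eq, sub_zero] at h1
    linarith
  obtain ⟨q₀, hq₀⟩ : ∃ q₀, (M ∩ q ⁻¹' {q₀}).Infinite := by
    by_contra! hcon
    exact hM (Set.Finite.of_finite_fibers q
      (((Set.finite_Iio P).prod Set.finite_univ).subset hqP) fun x _ => hcon x)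
  obtain ⟨N, hN⟩ := hdrop (δ / 2) (by positivity)
  let t : Fin N → ℕ := fun i => hq₀.natEmbedding _ i
  obtain ⟨i, hi⟩ := hN (-signedEval q₀) (by rw [norm_neg]; exact norm_signedEval_le _) ∅
    (fun i => {t i})
    (fun i j hij => by
      simpa [t, Subtype.val_inj, Fin.val_inj] using hij)
    (fun i => Set.empty_disjoint _)
  have hti : t i ∈ M ∩ q ⁻¹' {q₀} := (hq₀.natEmbedding _ i).2
  have h := hq (t i) (hMS hti.1)
  rw [show q (t i) = q₀ from hti.2, map_sub] at h
  rw [Set.empty_union, lpIndicator_empty, smul_zero, neg_apply,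
    neg_apply] at hi
  linarith


/-- There is no `F ∈ C^{1,+}(B_{ℓ∞}; c₀)` fixing all the unit vectors `e_n`; more
generally, none with `inf_n ‖F(e_n) - F(0)‖ > 0`. This generalizes Phillips' theorem
that `c₀` is not complemented in `ℓ∞`. Here `c₀` is identified with the closed subspace
of `ℓ∞` of sequences converging to `0`. -/
theorem no_smooth_retraction_onto_c0 :
    (¬∃ (F : lp (fun _ : ℕ => ℝ) ⊤ → lp (fun _ : ℕ => ℝ) ⊤)
        (F' : lp (fun _ : ℕ => ℝ) ⊤ → (lp (fun _ : ℕ => ℝ) ⊤ →L[ℝ] lp (fun _ : ℕ => ℝ) ⊤)),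
      ContinuousOn F (closedBall 0 1) ∧
      (∀ x ∈ closedBall (0 : lp (fun _ : ℕ => ℝ) ⊤) 1, MemCZero (F x)) ∧
      (∀ x ∈ ball (0 : lp (fun _ : ℕ => ℝ) ⊤) 1, HasFDerivAt F (F' x) x) ∧
      UniformContinuousOn F' (ball 0 1) ∧
      (∀ n : ℕ, F (lp.single ⊤ n 1) = lp.single ⊤ n 1)) ∧
    (¬∃ (F : lp (fun _ : ℕ => ℝ) ⊤ → lp (fun _ : ℕ => ℝ) ⊤)
        (F' : lp (fun _ : ℕ => ℝ) ⊤ → (lp (fun _ : ℕ => ℝ) ⊤ →L[ℝ] lp (fun _ : ℕ => ℝ) ⊤)),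
      ContinuousOn F (closedBall 0 1) ∧
      (∀ x ∈ closedBall (0 : lp (fun _ : ℕ => ℝ) ⊤) 1, MemCZero (F x)) ∧
      (∀ x ∈ ball (0 : lp (fun _ : ℕ => ℝ) ⊤) 1, HasFDerivAt F (F' x) x) ∧
      UniformContinuousOn F' (ball 0 1) ∧
      0 < ⨅ n : ℕ, ‖F (lp.single ⊤ n 1) - F 0‖) := by
  refine ⟨?_, ?_⟩
  · rintro ⟨F, F', hFc, hF0, hF, hF', he⟩
    obtain ⟨N, hN⟩ := Metric.tendsto_atTop.1 (hF0 0 (by simp)) (1 / 2) (by norm_num)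
    refine false_of_infinite_le_norm_single_sub hFc hF0 hF hF' (Set.Ici_infinite N)
      (δ := 1 / 2) (by norm_num) fun n hn => ?_
    have h1 := hN n hn
    have h2 := lp.norm_apply_le_norm ENNReal.top_ne_zero
      ((lp.single ⊤ n 1 : lp (fun _ : ℕ => ℝ) ⊤) - F 0) n
    rw [lp.coeFn_sub, Pi.sub_apply, lp.single_apply_self, Real.norm_eq_abs] at h2
    rw [Real.dist_eq, sub_zero, abs_lt] at h1
    rw [he]
    linarith [le_abs_self (1 - F 0 n)]
  · rintro ⟨F, F', hFc, hF0, hF, hF', he⟩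
    exact false_of_infinite_le_norm_single_sub hFc hF0 hF hF' Set.infinite_univ he fun n _ =>
      ciInf_le ⟨0, by rintro _ ⟨k, rfl⟩; exact norm_nonneg _⟩ n
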